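/- Let F be a field, n a positive integer with (n+1 : F) ≠ 0, and let P be the (n+1)×(n+1) matrix over F having first row all 1's and, for 2 ≤ k ≤ n+1, row k with P_{k,n+1} = 1, P_{k,n+2−k} = −1 and zeros elsewhere (P is invertible). Then the map f(a) := P*a*P⁻¹ is a bijection from the set of (n+1)×(n+1) matrices of the block form with arbitrary upper-left n×n block, zero last row and last column except the (n+1,n+1) entry equal to 1, onto the set gna(n,F) of (n+1)×(n+1) matrices all of whose row sums and column sums equal 1; moreover f preserves the affine commutator bracket: f(a*b − b*a + b) = f(a)*f(b) − f(b)*f(a) + f(b). -/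

import Mathlib

open Matrix BigOperators

/-- The matrix `P`: first row (index 0) all `1`'s; for rows `i ≥ 1`, the entry in the
last column is `1`, the entry in column `n - i` is `-1`, and all other entries are `0`.
(1-based: `P_{1,l} = 1`, and for `2 ≤ k ≤ n+1`: `P_{k,n+1} = 1`, `P_{k,n+2-k} = -1`.) -/
def Pmat (F : Type*) [Field F] (n : ℕ) : Matrix (Fin (n + 1)) (Fin (n + 1)) F :=
  Matrix.of fun i j =>
    if (i : ℕ) = 0 then 1
    else if (j : ℕ) = n then 1
    else if (i : ℕ) + (j : ℕ) = n then -1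
    else 0

/-- The matrix `Q`: last row (index n) all `1`'s; for rows `i ≤ n - 1`, the entry in
column `n - i` is `-n` and all other entries are `1`.
(1-based: `Q_{n+1,l} = 1`, and for `1 ≤ k ≤ n`: `Q_{k,n+2-k} = -n`, `Q_{k,l} = 1` otherwise.) -/
def Qmat (F : Type*) [Field F] (n : ℕ) : Matrix (Fin (n + 1)) (Fin (n + 1)) F :=
  Matrix.of fun i j =>
    if (i : ℕ) = n then 1
    else if (i : ℕ) + (j : ℕ) = n then -(n : F)
    else 1

lemma Pmat_apply_of_ne_zero (F : Type*) [Field F] (n : ℕ) {i : Fin (n + 1)} (hi : i ≠ 0)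
    (j : Fin (n + 1)) :
    Pmat F n i j = (if j = Fin.last n then 1 else 0) - (if j = i.rev then 1 else 0) := by
  have hi' : (i : ℕ) ≠ 0 := fun h => hi (Fin.ext h)
  have h1 : j = Fin.last n ↔ (j : ℕ) = n := by simp [Fin.ext_iff]
  have h2 : j = i.rev ↔ (i : ℕ) + (j : ℕ) = n := by
    rw [Fin.ext_iff, Fin.val_rev]
    lia
  simp only [Pmat, Matrix.of_apply, if_neg hi', h1, h2]
  by_cases hj : (j : ℕ) = n
  · simp [hj, hi']
  · by_cases hij : (i : ℕ) + (j : ℕ) = n <;> simp [hj, hij]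

lemma Pmat_zero_apply (F : Type*) [Field F] (n : ℕ) (j : Fin (n + 1)) : Pmat F n 0 j = 1 := by
  simp [Pmat]

lemma Pmat_mulVec_of_ne_zero (F : Type*) [Field F] (n : ℕ) (v : Fin (n + 1) → F)
    {i : Fin (n + 1)} (hi : i ≠ 0) :
    (Pmat F n *ᵥ v) i = v (Fin.last n) - v i.rev := by
  simp [Matrix.mulVec, dotProduct, Pmat_apply_of_ne_zero F n hi, sub_mul,
    Finset.sum_sub_distrib]

lemma isUnit_det_Pmat (F : Type*) [Field F] (n : ℕ) (hchar : (n : F) + 1 ≠ 0) :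
    IsUnit (Pmat F n).det := by
  rw [isUnit_iff_ne_zero]
  intro hdet
  obtain ⟨v, hv, hPv⟩ := Matrix.exists_mulVec_eq_zero_iff.mpr hdet
  have hconst : ∀ j, v j = v (Fin.last n) := by
    intro j
    by_cases hj : j = Fin.last n
    · rw [hj]
    · have hrev : j.rev ≠ 0 := fun h => hj (by rw [← Fin.rev_rev j, h, Fin.rev_zero])
      have h := Pmat_mulVec_of_ne_zero F n v hrev
      rw [hPv, Fin.rev_rev] at h
      exact (sub_eq_zero.mp h.symm).symm
  have hsum : ((n : F) + 1) * v (Fin.last n) = 0 := by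
    have h := congrFun hPv 0
    simpa [Matrix.mulVec, dotProduct, Pmat_zero_apply, hconst] using h
  have hlast := (mul_eq_zero.mp hsum).resolve_left hchar
  exact hv (funext fun j => (hconst j).trans hlast)

lemma Pmat_mulVec_single_last (F : Type*) [Field F] (n : ℕ) :
    Pmat F n *ᵥ Pi.single (Fin.last n) 1 = 1 := by
  ext i
  simp [Pmat]

lemma one_vecMul_Pmat (F : Type*) [Field F] (n : ℕ) :
    1 ᵥ* Pmat F n = ((n : F) + 1) • Pi.single (Fin.last n) 1 := by
  ext j
  have hrev (i : Fin n) : (j = i.succ.rev) ↔ (i.succ = j.rev) := by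
    rw [← Fin.rev_inj, Fin.rev_rev, eq_comm]
  simp only [Matrix.vecMul, dotProduct, Pi.one_apply, one_mul, Fin.sum_univ_succ,
    Pmat_zero_apply, Pmat_apply_of_ne_zero F n (Fin.succ_ne_zero _), Finset.sum_sub_distrib,
    hrev]
  by_cases hj : j = Fin.last n
  · subst hj
    simp [Fin.succ_ne_zero, add_comm]
  · obtain ⟨k, hk⟩ := Fin.exists_succ_eq.mpr
      (fun h : j.rev = 0 => hj (by rw [← Fin.rev_rev j, h, Fin.rev_zero]))
    simp [hj, ← hk]

lemma fixes_single_last_iff {F : Type*} [Field F] {n : ℕ}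
    (a : Matrix (Fin (n + 1)) (Fin (n + 1)) F) :
    (a (Fin.last n) (Fin.last n) = 1 ∧
      ∀ j, j ≠ Fin.last n → a (Fin.last n) j = 0 ∧ a j (Fin.last n) = 0) ↔
    a *ᵥ Pi.single (Fin.last n) 1 = Pi.single (Fin.last n) 1 ∧
      Pi.single (Fin.last n) 1 ᵥ* a = Pi.single (Fin.last n) 1 := by
  simp only [funext_iff, Matrix.mulVec_single_one, Matrix.single_one_vecMul, Matrix.col_apply,
    Matrix.row_apply, Pi.single_apply]
  constructor
  · rintro ⟨h, h'⟩
    constructor <;> intro j <;> by_cases hj : j = Fin.last n <;> simp_all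
  · rintro ⟨h, h'⟩
    refine ⟨by simp [h], fun j hj => ⟨by simp [h', hj], by simp [h, hj]⟩⟩

lemma sums_eq_one_iff_fixes_one {F ι : Type*} [Field F] [Fintype ι] (a : Matrix ι ι F) :
    ((∀ l, ∑ k, a l k = 1) ∧ (∀ l, ∑ k, a k l = 1)) ↔ a *ᵥ 1 = 1 ∧ 1 ᵥ* a = 1 := by
  simp [funext_iff, Matrix.mulVec, Matrix.vecMul, dotProduct]

/-- If `n + 1 ≠ 0` in `F`, the map `a ↦ P * a * P⁻¹` is a bijection from the set of
block matrices with arbitrary upper-left `n×n` block, zero last row and column except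
the `(n+1,n+1)` entry equal to `1`, onto `gna(n,F)` (all row and column sums equal `1`),
and it preserves the affine commutator bracket `⟦a,b⟧ = a*b - b*a + b`. -/
theorem Pmat_conj_gna (F : Type*) [Field F] (n : ℕ) (hn : 0 < n)
    (hchar : ((n : F) + 1) ≠ 0) :
    Set.BijOn (fun a : Matrix (Fin (n + 1)) (Fin (n + 1)) F => Pmat F n * a * (Pmat F n)⁻¹)
      {a | a (Fin.last n) (Fin.last n) = 1 ∧
           ∀ j, j ≠ Fin.last n → a (Fin.last n) j = 0 ∧ a j (Fin.last n) = 0}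
      {a | (∀ l, ∑ k, a l k = 1) ∧ (∀ l, ∑ k, a k l = 1)} ∧
    ∀ a b : Matrix (Fin (n + 1)) (Fin (n + 1)) F,
      Pmat F n * (a * b - b * a + b) * (Pmat F n)⁻¹ =
        (Pmat F n * a * (Pmat F n)⁻¹) * (Pmat F n * b * (Pmat F n)⁻¹)
          - (Pmat F n * b * (Pmat F n)⁻¹) * (Pmat F n * a * (Pmat F n)⁻¹)
          + Pmat F n * b * (Pmat F n)⁻¹ := by
  have hdet := isUnit_det_Pmat F n hchar
  have hPe := Pmat_mulVec_single_last F n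
  have hoP := one_vecMul_Pmat F n
  set P := Pmat F n
  have hPinv : P * P⁻¹ = 1 := Matrix.mul_nonsing_inv P hdet
  have hinvP : P⁻¹ * P = 1 := Matrix.nonsing_inv_mul P hdet
  have hPinv_one : P⁻¹ *ᵥ 1 = Pi.single (Fin.last n) 1 := by
    rw [← hPe, Matrix.mulVec_mulVec, hinvP, Matrix.one_mulVec]
  have hsingle_Pinv : ((n : F) + 1) • (Pi.single (Fin.last n) 1 ᵥ* P⁻¹) = 1 := by
    rw [← Matrix.smul_vecMul, ← hoP, Matrix.vecMul_vecMul, hPinv, Matrix.vecMul_one]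
  constructor
  · refine Set.InvOn.bijOn (f' := fun b => P⁻¹ * b * P) ⟨fun a _ => ?_, fun b _ => ?_⟩ ?_ ?_
    · simp only [Matrix.mul_assoc, hinvP, Matrix.mul_one]
      rw [← Matrix.mul_assoc, hinvP, Matrix.one_mul]
    · simp only [Matrix.mul_assoc, hPinv, Matrix.mul_one]
      rw [← Matrix.mul_assoc, hPinv, Matrix.one_mul]
    · intro a ha
      obtain ⟨hr, hl⟩ := (fixes_single_last_iff a).mp ha
      refine (sums_eq_one_iff_fixes_one _).mpr ⟨?_, ?_⟩
      · simp only [← Matrix.mulVec_mulVec, hPinv_one, hr, hPe]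
      · simp only [← Matrix.vecMul_vecMul, hoP, Matrix.smul_vecMul, hl, hsingle_Pinv]
    · intro b hb
      obtain ⟨hr, hl⟩ := (sums_eq_one_iff_fixes_one b).mp hb
      refine (fixes_single_last_iff _).mpr ⟨?_, ?_⟩
      · simp only [← Matrix.mulVec_mulVec, hPe, hr, hPinv_one]
      · refine smul_right_injective _ hchar ?_
        simp only [← Matrix.vecMul_vecMul, ← Matrix.smul_vecMul, hsingle_Pinv, hl, hoP]
  · intro a b
    have hmul (x y : Matrix (Fin (n + 1)) (Fin (n + 1)) F) :
        P * (x * y) * P⁻¹ = (P * x * P⁻¹) * (P * y * P⁻¹) := by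
      rw [show (P * x * P⁻¹) * (P * y * P⁻¹) = P * x * (P⁻¹ * P) * y * P⁻¹ by
        simp only [Matrix.mul_assoc], hinvP]
      simp only [Matrix.mul_assoc, Matrix.mul_one]
    rw [← hmul, ← hmul]
    simp only [Matrix.mul_add, Matrix.mul_sub, Matrix.add_mul, Matrix.sub_mul]
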